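/- Let M ⊆ ℂ^p × ℂ^q be such that for every a ∈ ℂ^p the fiber M_{(a,·)} := {w ∈ ℂ^q : (a,w) ∈ M} is pluripolar. Let C ⊆ ℂ^p × ℂ^q be such that the set {z ∈ ℂ^p : C_{(z,·)} is not pluripolar} is not pluripolar (for example C = C'×C'' with C' ⊆ ℂ^p and C'' ⊆ ℂ^q non-pluripolar). Then C∖M is not pluripolar. -/

import Mathlib

open Set Metric Filter

noncomputable section

section BasicDefs

variable {E : Type*} [NormedAddCommGroup E] [NormedSpace ℂ E]

/-- `u` is plurisubharmonic on the open set `Ω` : it is `[-∞,∞)`-valued on `Ω`, upper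
semicontinuous on `Ω`, and its restriction to each complex line is subharmonic there; the
latter is expressed by the classical harmonic-majorant criterion: on every closed disc
(in the line parameter) contained in `Ω`, `u` is dominated by every function harmonic inside
the disc and continuous up to the boundary (written as the real part of a holomorphic
function, the disc being simply connected) that dominates `u` on the boundary circle. -/
def PshOn (u : E → EReal) (Ω : Set E) : Prop :=
  (∀ x ∈ Ω, u x < ⊤) ∧ UpperSemicontinuousOn u Ω ∧
  ∀ (a b : E) (c : ℂ) (r : ℝ), 0 < r →
    (∀ t ∈ closedBall c r, a + t • b ∈ Ω) →
    ∀ f : ℂ → ℂ, ContinuousOn f (closedBall c r) →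
      DifferentiableOn ℂ f (ball c r) →
      (∀ t ∈ sphere c r, u (a + t • b) ≤ ((f t).re : EReal)) →
      ∀ t ∈ closedBall c r, u (a + t • b) ≤ ((f t).re : EReal)

/-- A set `P` is pluripolar if `P ⊆ u⁻¹(-∞)` for some plurisubharmonic `u ≢ -∞` on the
whole space. -/
def Pluripolar (P : Set E) : Prop :=
  ∃ u : E → EReal, PshOn u univ ∧ (¬ ∀ x, u x = ⊥) ∧ ∀ x ∈ P, u x = ⊥

/-- The defining family of the relative extremal function `h_{A,Ω}`. -/
def extrFamily (A Ω : Set E) : Set (E → EReal) :=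
  {u | PshOn u Ω ∧ (∀ x ∈ Ω, u x ≤ 1) ∧ ∀ x ∈ A, u x ≤ 0}

/-- The relative extremal function `h_{A,Ω}`. -/
def relExtr (A Ω : Set E) (z : E) : EReal :=
  ⨆ u ∈ extrFamily A Ω, u z

/-- Upper semicontinuous regularization `u*`. -/
def uscReg (u : E → EReal) (z : E) : EReal :=
  Filter.limsup u (nhds z)

/-- `h*_{A,Ω}`. -/
def relExtrStar (A Ω : Set E) (z : E) : EReal :=
  uscReg (relExtr A Ω) z

/-- A canonical exhaustion of an open set `Ω` by relatively compact open subsets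
`Ω_k ⊆ Ω_{k+1} ⋐ Ω` with `⋃ k, Ω_k = Ω`. -/
def exhaust (Ω : Set E) (k : ℕ) : Set E :=
  {x | ‖x‖ < (k : ℝ) + 1 ∧ closedBall x (1 / ((k : ℝ) + 1)) ⊆ Ω}

/-- `ω_{A,Ω} = lim_k h*_{A∩Ω_k,Ω_k}` (a decreasing limit, hence the infimum) along an
exhaustion of `Ω`; the limit is independent of the chosen exhaustion. -/
def omegaRel (A Ω : Set E) (z : E) : EReal :=
  ⨅ k : ℕ, relExtrStar (A ∩ exhaust Ω k) (exhaust Ω k) z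

/-- `A` is locally pluriregular: `A ≠ ∅` and `h*_{A∩Ω,Ω}(a) = 0` for every `a ∈ A` and every
open neighborhood `Ω` of `a`. -/
def LocPluriregular (A : Set E) : Prop :=
  A.Nonempty ∧ ∀ a ∈ A, ∀ Ω : Set E, IsOpen Ω → a ∈ Ω → relExtrStar (A ∩ Ω) Ω a = 0

/-- An open set `Ω` is pseudoconvex if `Ω` is the whole space or
`z ↦ -log dist(z, ∂Ω)` is plurisubharmonic on `Ω`. -/
def Pseudoconvex (Ω : Set E) : Prop :=
  IsOpen Ω ∧ (Ω = univ ∨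
    PshOn (fun z => ((- Real.log (infDist z Ωᶜ) : ℝ) : EReal)) Ω)

/-- `M` is a relatively closed subset of `U`. -/
def RelClosedIn (M U : Set E) : Prop :=
  M ⊆ U ∧ closure M ∩ U ⊆ M

/-- `g ∈ O(Ω)` admits no holomorphic extension to any neighborhood of `a`. -/
def NoHolExtAt (g : E → ℂ) (Ω : Set E) (a : E) : Prop :=
  ¬ ∃ (V : Set E) (h : E → ℂ), IsOpen V ∧ a ∈ V ∧
      DifferentiableOn ℂ h V ∧ ∀ x ∈ V ∩ Ω, h x = g x

end BasicDefs

section TwoFold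

variable {E F : Type*} [NormedAddCommGroup E] [NormedSpace ℂ E]
  [NormedAddCommGroup F] [NormedSpace ℂ F]

/-- The 2-fold cross `𝕏(A,B;D,G) = (A×G) ∪ (D×B)`. -/
def Cross2 (A : Set E) (B : Set F) (D : Set E) (G : Set F) : Set (E × F) :=
  (A ×ˢ G) ∪ (D ×ˢ B)

/-- `X̂ = {(z,w) ∈ D×G : ω_{A,D}(z) + ω_{B,G}(w) < 1}`. -/
def CrossHat2 (A : Set E) (B : Set F) (D : Set E) (G : Set F) : Set (E × F) :=
  {p | p.1 ∈ D ∧ p.2 ∈ G ∧ omegaRel A D p.1 + omegaRel B G p.2 < 1}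

/-- `f ∈ O_s(X∖M)` for the 2-fold cross `X = 𝕏(A,B;D,G)`. -/
def SepHol2 (A : Set E) (B : Set F) (D : Set E) (G : Set F) (M : Set (E × F))
    (f : E × F → ℂ) : Prop :=
  (∀ a ∈ A, DifferentiableOn ℂ (fun w => f (a, w)) (G \ {w | (a, w) ∈ M})) ∧
  (∀ b ∈ B, DifferentiableOn ℂ (fun z => f (z, b)) (D \ {z | (z, b) ∈ M}))

end TwoFold

section NFold

variable {N : ℕ} {n : Fin N → ℕ}

/-- The `N`-fold cross `𝕏(A_1,…,A_N;D_1,…,D_N)`. -/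
def CrossN (A D : ∀ j : Fin N, Set (Fin (n j) → ℂ)) : Set (∀ j, Fin (n j) → ℂ) :=
  {z | ∃ j, z j ∈ D j ∧ ∀ i, i ≠ j → z i ∈ A i}

/-- `X̂ := {(z_1,…,z_N) ∈ D_1×⋯×D_N : Σ_j ω_{A_j,D_j}(z_j) < 1}`. -/
def CrossHatN (A D : ∀ j : Fin N, Set (Fin (n j) → ℂ)) : Set (∀ j, Fin (n j) → ℂ) :=
  {z | (∀ j, z j ∈ D j) ∧ ∑ j, omegaRel (A j) (D j) (z j) < 1}

/-- Insert the value `w` in the `j`-th slot of the partial tuple `y`. -/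
def glueAt (j : Fin N) (y : ∀ i : {i : Fin N // i ≠ j}, Fin (n i.1) → ℂ)
    (w : Fin (n j) → ℂ) : ∀ i, Fin (n i) → ℂ :=
  fun i => if h : i = j then cast (by rw [h]) w else y ⟨i, h⟩

/-- Forget the `j`-th slot of a tuple. -/
def dropAt (j : Fin N) (z : ∀ i, Fin (n i) → ℂ) :
    ∀ i : {i : Fin N // i ≠ j}, Fin (n i.1) → ℂ :=
  fun i => z i.1

/-- `Σ_j = {(z',z'') ∈ (A_1×⋯×A_{j-1})×(A_{j+1}×⋯×A_N) : M_{(z',·,z'')} not pluripolar}`. -/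
def SigmaSet (A : ∀ j : Fin N, Set (Fin (n j) → ℂ)) (M : Set (∀ j, Fin (n j) → ℂ))
    (j : Fin N) : Set (∀ i : {i : Fin N // i ≠ j}, Fin (n i.1) → ℂ) :=
  {y | (∀ i, y i ∈ A i.1) ∧ ¬ Pluripolar {w : Fin (n j) → ℂ | glueAt j y w ∈ M}}

/-- The generalized `N`-fold cross `𝕋(A_1,…,A_N;D_1,…,D_N;S_1,…,S_N)`. -/
def CrossT (A D : ∀ j : Fin N, Set (Fin (n j) → ℂ))
    (S : ∀ j : Fin N, Set (∀ i : {i : Fin N // i ≠ j}, Fin (n i.1) → ℂ)) :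
    Set (∀ j, Fin (n j) → ℂ) :=
  {z | ∃ j, z j ∈ D j ∧ (∀ i, i ≠ j → z i ∈ A i) ∧ dropAt j z ∉ S j}

/-- `f ∈ O_s(X∖M)` for the `N`-fold cross `X = 𝕏(A_1,…,A_N;D_1,…,D_N)`. -/
def SepHolN (A D : ∀ j : Fin N, Set (Fin (n j) → ℂ)) (M : Set (∀ j, Fin (n j) → ℂ))
    (f : (∀ j, Fin (n j) → ℂ) → ℂ) : Prop :=
  ∀ (j : Fin N) (a : ∀ i, Fin (n i) → ℂ), (∀ i, a i ∈ A i) →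
    DifferentiableOn ℂ (fun w => f (Function.update a j w))
      (D j \ {w | Function.update a j w ∈ M})

/-- `f ∈ O_s(T)` for the generalized cross `T = 𝕋(A;D;S)`. -/
def SepHolT (A D : ∀ j : Fin N, Set (Fin (n j) → ℂ))
    (S : ∀ j : Fin N, Set (∀ i : {i : Fin N // i ≠ j}, Fin (n i.1) → ℂ))
    (f : (∀ j, Fin (n j) → ℂ) → ℂ) : Prop :=
  ∀ (j : Fin N) (y : ∀ i : {i : Fin N // i ≠ j}, Fin (n i.1) → ℂ),
    (∀ i, y i ∈ A i.1) → y ∉ S j →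
    DifferentiableOn ℂ (fun w => f (glueAt j y w)) (D j)

end NFold

/-- A strict gap `u + v < h` between upper semicontinuous functions `u`, `v` and a continuous
function `h` can be split continuously. -/
theorem exists_continuous_split {X : Type*} [TopologicalSpace X] [NormalSpace X]
    [ParacompactSpace X] {u v : X → EReal} {h : X → ℝ}
    (hu : UpperSemicontinuous u) (hv : UpperSemicontinuous v) (hh : Continuous h)
    (hut : ∀ x, u x < ⊤) (hvt : ∀ x, v x < ⊤) (huv : ∀ x, u x + v x < (h x : EReal)) :
    ∃ φ : C(X, ℝ), ∀ x, u x < (φ x : EReal) ∧ v x < ((h x - φ x : ℝ) : EReal) := by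
  refine exists_continuous_forall_mem_convex_of_local_const
    (t := fun x => {c : ℝ | u x < (c : EReal) ∧ v x < ((h x - c : ℝ) : EReal)}) ?_ ?_
  · intro x
    refine Set.OrdConnected.convex ⟨fun a ha b hb c hc => ⟨?_, ?_⟩⟩
    · exact ha.1.trans_le (by exact_mod_cast hc.1)
    · exact hb.2.trans_le (by exact_mod_cast (by linarith [hc.2] : h x - b ≤ h x - c))
  · intro x
    have key : ∃ c d : ℝ, u x < (c : EReal) ∧ v x < (d : EReal) ∧ d < h x - c := by
      have h1 := huv x
      have h2 := hut x
      have h3 := hvt x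
      generalize u x = a at *
      generalize v x = b at *
      induction a with
      | top => simp at h2
      | bot =>
        induction b with
        | top => simp at h3
        | bot => exact ⟨0, h x - 1, EReal.bot_lt_coe _, EReal.bot_lt_coe _, by linarith⟩
        | coe b =>
          exact ⟨h x - b - 2, b + 1, EReal.bot_lt_coe _, by exact_mod_cast lt_add_one b,
            by linarith⟩
      | coe a =>
        induction b with
        | top => simp at h3
        | bot =>
          exact ⟨a + 1, h x - a - 2, by exact_mod_cast lt_add_one a, EReal.bot_lt_coe _,
            by linarith⟩
        | coe b =>
          have h4 : a + b < h x := by exact_mod_cast h1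
          refine ⟨a + (h x - a - b) / 3, b + (h x - a - b) / 3, ?_, ?_, by linarith⟩
          · exact_mod_cast (by linarith : a < a + (h x - a - b) / 3)
          · exact_mod_cast (by linarith : b < b + (h x - a - b) / 3)
    obtain ⟨c, d, hc, hd, hcd⟩ := key
    refine ⟨c, ?_⟩
    have hev : ∀ᶠ y in nhds x, d < h y - c :=
      (hh.sub continuous_const).continuousAt.eventually (lt_mem_nhds hcd)
    filter_upwards [hu x _ hc, hv x _ hd, hev] with y h1 h2 h3
    exact ⟨h1, h2.trans (by exact_mod_cast h3)⟩

/-- Real parts of entire functions are uniformly dense in the continuous real functions on the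
unit circle. -/
theorem exists_entire_re_near_unitCircle (φ : C(UnitAddCircle, ℝ)) {ε : ℝ} (hε : 0 < ε) :
    ∃ P : ℂ → ℂ, Differentiable ℂ P ∧
      ∀ x : UnitAddCircle, |(P (AddCircle.toCircle x : ℂ)).re - φ x| ≤ ε := by
  have hspan : ∀ g ∈ Submodule.span ℂ (range (fourier : ℤ → C(UnitAddCircle, ℂ))), ∀ c : ℂ,
      ∃ P : ℂ → ℂ, Differentiable ℂ P ∧
        ∀ x : UnitAddCircle, (P (AddCircle.toCircle x : ℂ)).re = (c * g x).re := by
    intro g hg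
    induction hg using Submodule.span_induction with
    | mem g hg =>
      obtain ⟨n, rfl⟩ := hg
      intro c
      obtain ⟨m, rfl | rfl⟩ := n.eq_nat_or_neg
      · refine ⟨fun z => c * z ^ m, by fun_prop, fun x => ?_⟩
        simp [fourier_apply, AddCircle.toCircle_nsmul]
      · refine ⟨fun z => (starRingEnd ℂ) c * z ^ m, by fun_prop, fun x => ?_⟩
        rw [fourier_neg, ← Complex.conj_re, map_mul, Complex.conj_conj]
        simp [fourier_apply, AddCircle.toCircle_nsmul]
    | zero => exact fun c => ⟨0, differentiable_const 0, by simp⟩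
    | add f g _ _ hf hg =>
      intro c
      obtain ⟨P, hP, hPf⟩ := hf c
      obtain ⟨Q, hQ, hQg⟩ := hg c
      exact ⟨P + Q, hP.add hQ, fun x => by
        rw [Pi.add_apply, Complex.add_re, hPf, hQg, ContinuousMap.add_apply, mul_add,
          Complex.add_re]⟩
    | smul a f _ hf =>
      intro c
      obtain ⟨P, hP, hPf⟩ := hf (c * a)
      exact ⟨P, hP, fun x => by rw [hPf, ContinuousMap.smul_apply, smul_eq_mul, mul_assoc]⟩
  let Φ : C(UnitAddCircle, ℂ) := ⟨fun x => (φ x : ℂ), by fun_prop⟩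
  have hΦ : Φ ∈ (Submodule.span ℂ (range (fourier : ℤ → C(UnitAddCircle, ℂ)))).topologicalClosure
      := by
    rw [span_fourier_closure_eq_top]
    trivial
  obtain ⟨g, hg, hdist⟩ := Metric.mem_closure_iff.1 hΦ ε hε
  obtain ⟨P, hP, hPg⟩ := hspan g hg 1
  refine ⟨P, hP, fun x => ?_⟩
  have h1 : ‖g x - Φ x‖ ≤ ε := by
    rw [← dist_eq_norm, dist_comm]
    exact (ContinuousMap.dist_apply_le_dist x).trans hdist.le
  have h2 := (Complex.abs_re_le_norm _).trans h1
  simpa [hPg, Φ] using h2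

/-- On a circle, a pair of upper semicontinuous functions with `u + v < h` is dominated by real
parts of entire functions whose sum is at most `h + ε`. -/
theorem exists_entire_majorants {u v : ℂ → EReal} {h : ℂ → ℝ} {c : ℂ} {r ε : ℝ}
    (hr : 0 < r) (hε : 0 < ε)
    (hu : UpperSemicontinuous u) (hv : UpperSemicontinuous v)
    (hh : ContinuousOn h (sphere c r))
    (hut : ∀ t, u t < ⊤) (hvt : ∀ t, v t < ⊤)
    (huv : ∀ t ∈ sphere c r, u t + v t < (h t : EReal)) :
    ∃ P Q : ℂ → ℂ, Differentiable ℂ P ∧ Differentiable ℂ Q ∧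
      ∀ t ∈ sphere c r, u t ≤ ((P t).re : EReal) ∧ v t ≤ ((Q t).re : EReal) ∧
        (P t).re + (Q t).re ≤ h t + ε := by
  let e : UnitAddCircle → ℂ := fun x => c + r * (AddCircle.toCircle x : ℂ)
  have he : Continuous e := by
    have : Continuous (AddCircle.toCircle : UnitAddCircle → Circle) := AddCircle.continuous_toCircle
    fun_prop
  have hmem : ∀ x, e x ∈ sphere c r := fun x => by
    simp [e, abs_of_pos hr, Circle.norm_coe (AddCircle.toCircle x)]
  have hhe : Continuous (fun x => h (e x)) := hh.comp_continuous he hmem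
  obtain ⟨φ, hφ⟩ := exists_continuous_split (u := fun x => u (e x)) (v := fun x => v (e x))
    (hu.comp he) (hv.comp he) hhe (fun x => hut _) (fun x => hvt _) (fun x => huv _ (hmem x))
  obtain ⟨P, hP, hPφ⟩ := exists_entire_re_near_unitCircle φ (ε := ε / 4) (by positivity)
  obtain ⟨Q, hQ, hQφ⟩ := exists_entire_re_near_unitCircle (⟨_, hhe⟩ - φ) (ε := ε / 4)
    (by positivity)
  refine ⟨fun t => P ((t - c) / r) + (ε / 4 : ℝ), fun t => Q ((t - c) / r) + (ε / 4 : ℝ),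
    by fun_prop, by fun_prop, fun t ht => ?_⟩
  have hr0 : (r : ℂ) ≠ 0 := by exact_mod_cast hr.ne'
  have hnorm : ‖(t - c) / (r : ℂ)‖ = 1 := by
    rw [norm_div, ← dist_eq_norm, mem_sphere.1 ht, Complex.norm_real, Real.norm_of_nonneg hr.le,
      div_self hr.ne']
  obtain ⟨x, hx⟩ := (AddCircle.homeomorphCircle (T := 1) one_ne_zero).surjective
    ⟨(t - c) / (r : ℂ), mem_sphere_zero_iff_norm.2 hnorm⟩
  rw [AddCircle.homeomorphCircle_apply] at hx
  have hx' : (AddCircle.toCircle x : ℂ) = (t - c) / r := by rw [hx]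
  have hex : e x = t := by
    simp only [e, hx']
    field_simp
    ring
  have h1 := abs_le.1 (hPφ x)
  have h2 := abs_le.1 (hQφ x)
  obtain ⟨h3, h4⟩ := hφ x
  rw [ContinuousMap.sub_apply, ContinuousMap.coe_mk] at h2
  simp only [hx', hex] at h1 h2 h3 h4
  simp only [Complex.add_re, Complex.ofReal_re]
  refine ⟨h3.le.trans ?_, h4.le.trans ?_, by linarith⟩
  · exact_mod_cast (by linarith)
  · exact_mod_cast (by linarith)

/-- Maximum principle for real parts of holomorphic functions on a disc. -/
theorem re_le_of_forall_sphere_re_le {f : ℂ → ℂ} {c : ℂ} {r K : ℝ} (hr : 0 < r)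
    (hc : ContinuousOn f (closedBall c r)) (hd : DifferentiableOn ℂ f (ball c r))
    (hK : ∀ t ∈ sphere c r, (f t).re ≤ K) : ∀ t ∈ closedBall c r, (f t).re ≤ K := by
  intro t ht
  have hdc : DiffContOnCl ℂ (fun z => Complex.exp (f z)) (ball c r) :=
    ⟨hd.cexp, by rw [closure_ball c hr.ne']; exact hc.cexp⟩
  have h1 := Complex.norm_le_of_forall_mem_frontier_norm_le isBounded_ball hdc
    (C := Real.exp K) (fun z hz => ?_) (z := t) (by rwa [closure_ball c hr.ne'])
  · rwa [Complex.norm_exp, Real.exp_le_exp] at h1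
  · rw [frontier_ball c hr.ne'] at hz
    rw [Complex.norm_exp, Real.exp_le_exp]
    exact hK z hz

section Psh

variable {E F : Type*} [NormedAddCommGroup E] [NormedSpace ℂ E]
  [NormedAddCommGroup F] [NormedSpace ℂ F]

theorem PshOn.lt_top {u : E → EReal} (hu : PshOn u univ) (x : E) : u x < ⊤ :=
  hu.1 x (mem_univ x)

theorem PshOn.upperSemicontinuous {u : E → EReal} (hu : PshOn u univ) :
    UpperSemicontinuous u :=
  upperSemicontinuousOn_univ_iff.1 hu.2.1

theorem PshOn.comp_affine {u : F → EReal} (hu : PshOn u univ) (a : F) (L : E →L[ℂ] F) :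
    PshOn (fun x => u (a + L x)) univ := by
  refine ⟨fun x _ => hu.lt_top _, ?_, ?_⟩
  · exact upperSemicontinuousOn_univ_iff.2 (hu.upperSemicontinuous.comp (by fun_prop))
  · intro x y c r hr _ f hf hf' hs t ht
    have h := hu.2.2 (a + L x) (L y) c r hr (fun _ _ => mem_univ _) f hf hf'
    simp only [map_add, map_smul, ← add_assoc] at hs ⊢
    exact h hs t ht

theorem PshOn.restrict_line {u : E → EReal} (hu : PshOn u univ) (a b : E) :
    PshOn (fun t : ℂ => u (a + t • b)) univ :=
  hu.comp_affine a (ContinuousLinearMap.toSpanSingleton ℂ b)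

/-- The harmonic-majorant criterion for a subharmonic function on `ℂ`. -/
theorem PshOn.le_re {u : ℂ → EReal} (hu : PshOn u univ) {c : ℂ} {r : ℝ} (hr : 0 < r)
    {P : ℂ → ℂ} (hP : Differentiable ℂ P) (h : ∀ t ∈ sphere c r, u t ≤ ((P t).re : EReal)) :
    ∀ t ∈ closedBall c r, u t ≤ ((P t).re : EReal) := by
  simpa using hu.2.2 0 1 c r hr (fun _ _ => mem_univ _) P hP.continuous.continuousOn
    hP.differentiableOn (by simpa using h)

theorem PshOn.add {u v : E → EReal} (hu : PshOn u univ) (hv : PshOn v univ) :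
    PshOn (fun x => u x + v x) univ := by
  refine ⟨fun x _ => EReal.add_lt_top (hu.lt_top x).ne (hv.lt_top x).ne, ?_, ?_⟩
  · refine upperSemicontinuousOn_univ_iff.2
      (hu.upperSemicontinuous.add' hv.upperSemicontinuous fun x => ?_)
    exact EReal.continuousAt_add (Or.inl (hu.lt_top x).ne) (Or.inr (hv.lt_top x).ne)
  · intro a b c r hr _ f hf hf' hs t ht
    have hu' := hu.restrict_line a b
    have hv' := hv.restrict_line a b
    refine EReal.le_of_forall_lt_iff_le.1 fun z hz => ?_
    obtain ⟨ε, hε, hzε⟩ : ∃ ε : ℝ, 0 < ε ∧ (f t).re + (ε + ε) = z := by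
      have : (f t).re < z := by exact_mod_cast hz
      exact ⟨(z - (f t).re) / 2, by linarith, by ring⟩
    obtain ⟨P, Q, hP, hQ, hPQ⟩ := exists_entire_majorants (h := fun t => (f t).re + ε) hr hε
      hu'.upperSemicontinuous hv'.upperSemicontinuous
      ((Complex.continuous_re.comp_continuousOn (hf.mono sphere_subset_closedBall)).add
        continuousOn_const) hu'.lt_top hv'.lt_top
      (fun s hs' => (hs s hs').trans_lt (by exact_mod_cast lt_add_of_pos_right _ hε))
    have h1 := hu'.le_re hr hP (fun s hs => (hPQ s hs).1) t ht
    have h2 := hv'.le_re hr hQ (fun s hs => (hPQ s hs).2.1) t ht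
    have h3 := re_le_of_forall_sphere_re_le (f := fun s => P s + Q s - f s) (K := ε + ε) hr
      ((hP.continuous.add hQ.continuous).continuousOn.sub hf)
      ((hP.add hQ).differentiableOn.sub hf')
      (fun s hs => by
        have := (hPQ s hs).2.2
        simp only [Complex.sub_re, Complex.add_re]
        linarith) t ht
    refine (add_le_add h1 h2).trans ?_
    simp only [Complex.sub_re, Complex.add_re] at h3
    exact_mod_cast (by linarith : (P t).re + (Q t).re ≤ z)

/-- Harnack-type lower bound for the real part of an entire function. -/
theorem neg_le_re_one_of_re_le {P : ℂ → ℂ} (hP : Differentiable ℂ P) {K : ℝ} (hK : 0 < K)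
    (h : ∀ t ∈ closedBall (0 : ℂ) 2, (P t).re ≤ K) :
    -(2 * K + 3 * |(P 0).re|) ≤ (P 1).re := by
  have key := Complex.borelCaratheodory (f := fun t => P t - (P 0).im * Complex.I) (R := 2)
    (z := 1) hK (by fun_prop) (fun t ht => by simpa using h t (ball_subset_closedBall ht))
    two_pos (by simp)
  have h0 : P 0 - (P 0).im * Complex.I = ((P 0).re : ℂ) := by
    apply Complex.ext <;> simp
  simp only [h0, Complex.norm_real, Real.norm_eq_abs, norm_one] at key
  have h1 := (Complex.abs_re_le_norm _).trans key
  simp only [Complex.sub_re, Complex.mul_re, Complex.ofReal_re, Complex.I_re, Complex.ofReal_im,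
    Complex.I_im] at h1
  linarith [(abs_le.1 h1).1]

/-- Two subharmonic functions on `ℂ` that are finite somewhere are finite at a common point. -/
theorem PshOn.exists_add_ne_bot {u v : ℂ → EReal} (hu : PshOn u univ) (hv : PshOn v univ)
    (hu0 : u 0 ≠ ⊥) (hv1 : v 1 ≠ ⊥) : ∃ t, u t + v t ≠ ⊥ := by
  by_contra! hbot
  have hbound : ∀ w : ℂ → EReal, PshOn w univ →
      ∃ B : ℝ, ∀ t ∈ sphere (0 : ℂ) 2, w t < (B : EReal) := by
    intro w hw
    obtain ⟨s, -, hs⟩ := (hw.upperSemicontinuous.upperSemicontinuousOn _).exists_isMaxOn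
      (NormedSpace.sphere_nonempty.2 zero_le_two) (isCompact_sphere (0 : ℂ) 2)
    obtain ⟨B, hB, -⟩ := EReal.lt_iff_exists_real_btwn.1 (hw.lt_top s)
    exact ⟨B, fun t ht => (hs ht).trans_lt hB⟩
  obtain ⟨B₁, hB₁⟩ := hbound u hu
  obtain ⟨B₂, hB₂⟩ := hbound v hv
  obtain ⟨B, hB, hB₁B, hB₂B⟩ : ∃ B : ℝ, 0 < B ∧ B₁ ≤ B ∧ B₂ ≤ B :=
    ⟨|B₁| + |B₂| + 1, by positivity, by linarith [le_abs_self B₁, abs_nonneg B₂],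
      by linarith [le_abs_self B₂, abs_nonneg B₁]⟩
  obtain ⟨α, hα⟩ : ∃ α : ℝ, (α : EReal) = u 0 :=
    ⟨_, EReal.coe_toReal (hu.lt_top 0).ne hu0⟩
  obtain ⟨β, hβ⟩ : ∃ β : ℝ, (β : EReal) = v 1 :=
    ⟨_, EReal.coe_toReal (hv.lt_top 1).ne hv1⟩
  obtain ⟨N, hN⟩ : ∃ N : ℝ, N = 5 * (B + 1) + 3 * |α| + |β| + 2 := ⟨_, rfl⟩
  have hN0 : 0 < N := by rw [hN]; positivity
  have husc : ∀ w : ℂ → EReal, PshOn w univ →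
      UpperSemicontinuous (fun t => max (w t) ((-N - B : ℝ) : EReal)) := fun w hw =>
    hw.upperSemicontinuous.sup upperSemicontinuous_const
  obtain ⟨P, Q, hP, hQ, hPQ⟩ := exists_entire_majorants (h := fun _ => -N) (c := 0) (r := 2)
    two_pos one_pos (husc u hu) (husc v hv) continuousOn_const
    (fun t => max_lt (hu.lt_top t) (EReal.coe_lt_top _))
    (fun t => max_lt (hv.lt_top t) (EReal.coe_lt_top _)) (fun t ht => by
      have hmax : ∀ w : EReal, w < (B : EReal) →
          ((-N - B : ℝ) : EReal) + max w ((-N - B : ℝ) : EReal) < ((-N : ℝ) : EReal) := by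
        intro w hw
        have h1 : max w ((-N - B : ℝ) : EReal) < (B : EReal) :=
          max_lt hw (by exact_mod_cast (by linarith))
        have h2 := EReal.add_lt_add_left_coe h1 (-N - B)
        rwa [← EReal.coe_add, sub_add_cancel] at h2
      rcases EReal.add_eq_bot_iff.1 (hbot t) with h | h
      · rw [h, max_eq_right bot_le]
        exact hmax _ ((hB₂ t ht).trans_le (by exact_mod_cast hB₂B))
      · rw [h, max_eq_right (a := ⊥) bot_le, add_comm]
        exact hmax _ ((hB₁ t ht).trans_le (by exact_mod_cast hB₁B)))
  have hPB : ∀ t ∈ closedBall (0 : ℂ) 2, (P t).re ≤ B + 1 :=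
    re_le_of_forall_sphere_re_le two_pos hP.continuous.continuousOn hP.differentiableOn
      fun t ht => by
        obtain ⟨-, h2, h3⟩ := hPQ t ht
        have : -N - B ≤ (Q t).re := by exact_mod_cast (le_max_right _ _).trans h2
        linarith
  have hsum : (P 1 + Q 1).re ≤ -N + 1 :=
    re_le_of_forall_sphere_re_le (f := fun t => P t + Q t) two_pos
      (hP.continuous.add hQ.continuous).continuousOn (hP.add hQ).differentiableOn
      (fun t ht => (hPQ t ht).2.2) 1 (by simp)
  have hP0 : α ≤ (P 0).re := by
    have := hu.le_re two_pos hP (fun t ht => (le_max_left _ _).trans (hPQ t ht).1) 0 (by simp)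
    rw [← hα] at this
    exact_mod_cast this
  have hQ1 : β ≤ (Q 1).re := by
    have := hv.le_re two_pos hQ (fun t ht => (le_max_left _ _).trans (hPQ t ht).2.1) 1 (by simp)
    rw [← hβ] at this
    exact_mod_cast this
  have hP1 := neg_le_re_one_of_re_le hP (by linarith) hPB
  have habs : |(P 0).re| ≤ B + 1 + |α| :=
    abs_le.2 ⟨by linarith [neg_abs_le α], by linarith [hPB 0 (by simp), abs_nonneg α]⟩
  rw [Complex.add_re] at hsum
  linarith [neg_abs_le β]

theorem Pluripolar.mono {A B : Set E} (hB : Pluripolar B) (h : A ⊆ B) : Pluripolar A :=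
  let ⟨u, hu, hne, hbot⟩ := hB
  ⟨u, hu, hne, fun x hx => hbot x (h hx)⟩

theorem Pluripolar.union {A B : Set E} (hA : Pluripolar A) (hB : Pluripolar B) :
    Pluripolar (A ∪ B) := by
  obtain ⟨u, hu, hune, hubot⟩ := hA
  obtain ⟨v, hv, hvne, hvbot⟩ := hB
  obtain ⟨a, ha⟩ := not_forall.1 hune
  obtain ⟨b, hb⟩ := not_forall.1 hvne
  refine ⟨_, hu.add hv, fun hbot => ?_, ?_⟩
  · obtain ⟨t, ht⟩ := (hu.restrict_line a (b - a)).exists_add_ne_bot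
      (hv.restrict_line a (b - a)) (by simpa using ha) (by simpa using hb)
    exact ht (hbot _)
  · rintro x (hx | hx)
    · simp [hubot x hx]
    · simp [hvbot x hx]

/-- The set of base points over which a plurisubharmonic function `u ≢ -∞` is identically `-∞`
on the fiber is pluripolar. -/
theorem PshOn.pluripolar_setOf_fiber_bot {u : E × F → EReal} (hu : PshOn u univ)
    (hne : ¬ ∀ x, u x = ⊥) : Pluripolar {z : E | ∀ w : F, u (z, w) = ⊥} := by
  obtain ⟨⟨z₀, w₀⟩, h₀⟩ := not_forall.1 hne
  refine ⟨_, hu.comp_affine (0, w₀) (ContinuousLinearMap.inl ℂ E F), fun h => h₀ ?_, ?_⟩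
  · simpa using h z₀
  · intro z hz
    simpa using hz w₀

end Psh

/-- **Lemma 8(b).** Let `M ⊆ ℂ^p × ℂ^q` have all fibers `M_{(a,·)}` (`a ∈ ℂ^p`) pluripolar
and let `C ⊆ ℂ^p × ℂ^q` be such that `{z ∈ ℂ^p : C_{(z,·)} not pluripolar}` is not
pluripolar. Then `C∖M` is not pluripolar. -/
theorem lemma_eight_b
    (p q : ℕ) (M C : Set ((Fin p → ℂ) × (Fin q → ℂ)))
    (hM : ∀ a : Fin p → ℂ, Pluripolar {w : Fin q → ℂ | (a, w) ∈ M})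
    (hC : ¬ Pluripolar {z : Fin p → ℂ | ¬ Pluripolar {w : Fin q → ℂ | (z, w) ∈ C}}) :
    ¬ Pluripolar (C \ M) := by
  rintro ⟨u, hu, hne, hbot⟩
  refine hC ((hu.pluripolar_setOf_fiber_bot hne).mono fun z hz => ?_)
  by_contra hfib
  have hslice := hu.comp_affine (z, 0) (ContinuousLinearMap.inr ℂ (Fin p → ℂ) (Fin q → ℂ))
  have hdiff : Pluripolar {w : Fin q → ℂ | (z, w) ∈ C \ M} :=
    ⟨_, hslice, fun h => hfib fun w => by simpa using h w, fun w hw => by simpa using hbot _ hw⟩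
  refine hz ((hdiff.union (hM z)).mono fun w hw => ?_)
  by_cases hwM : (z, w) ∈ M
  · exact Or.inr hwM
  · exact Or.inl ⟨hw, hwM⟩
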